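/- Let G = (V,E) be a finite DAG, let Π_A and Π_B be valid coarsening partitions of G, and let Π be their common refinement, whose parts are the nonempty intersections U ∩ W with U ∈ Π_A and W ∈ Π_B. If the quotient graph of G by Π contains a directed cycle, then the quotient graph of G by Π_A or the quotient graph of G by Π_B contains a directed cycle. -/

import Mathlib

/-- The quotient-graph edge relation induced by `E` on the parts of `P`. -/
def QuotRel {V : Type*} (E : V → V → Prop) (P : Set (Set V)) (π ρ : Set V) : Prop :=
  π ∈ P ∧ ρ ∈ P ∧ π ≠ ρ ∧ ∃ v ∈ π, ∃ w ∈ ρ, E v w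

/-- `P` is a valid coarsening partition of the DAG with edges `E`:
a partition of `V` whose quotient graph is acyclic. -/
def ValidCoarsening {V : Type*} (E : V → V → Prop) (P : Set (Set V)) : Prop :=
  Setoid.IsPartition P ∧ ∀ π, ¬ Relation.TransGen (QuotRel E P) π π

/-- `P` refines `Q`: every part of `P` is contained in some part of `Q`. -/
def Refines {V : Type*} (P Q : Set (Set V)) : Prop :=
  ∀ π ∈ P, ∃ ρ ∈ Q, π ⊆ ρ

/-- The common refinement of two partitions: the nonempty intersections of their parts. -/
def CommonRefinement {V : Type*} (P Q : Set (Set V)) : Set (Set V) :=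
  {s | s.Nonempty ∧ ∃ U ∈ P, ∃ W ∈ Q, s = U ∩ W}

/-- One step in the quotient by the common refinement projects to a weak step in each quotient,
and to a strict step in at least one of them. -/
theorem quotRel_step {V : Type*} {E : V → V → Prop} {PA PB : Set (Set V)} {U W t : Set V}
    (hU : U ∈ PA) (hW : W ∈ PB)
    (h : QuotRel E (CommonRefinement PA PB) (U ∩ W) t) :
    ∃ U' ∈ PA, ∃ W' ∈ PB, t = U' ∩ W' ∧
      (U = U' ∨ QuotRel E PA U U') ∧ (W = W' ∨ QuotRel E PB W W') ∧
      (QuotRel E PA U U' ∨ QuotRel E PB W W') := by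
  obtain ⟨-, ⟨-, U', hU', W', hW', rfl⟩, hne, v, hv, w, hw, hE⟩ := h
  have a : U = U' ∨ QuotRel E PA U U' := by
    by_cases e : U = U'
    · exact Or.inl e
    · exact Or.inr ⟨hU, hU', e, v, hv.1, w, hw.1, hE⟩
  have b : W = W' ∨ QuotRel E PB W W' := by
    by_cases e : W = W'
    · exact Or.inl e
    · exact Or.inr ⟨hW, hW', e, v, hv.2, w, hw.2, hE⟩
  refine ⟨U', hU', W', hW', rfl, a, b, ?_⟩
  rcases a with rfl | a
  · rcases b with rfl | b
    · exact absurd rfl hne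
    · exact Or.inr b
  · exact Or.inl a

/-- A path in the quotient by the common refinement projects to weak paths in both quotients,
at least one of which is nontrivial. -/
theorem quotRel_path {V : Type*} {E : V → V → Prop} {PA PB : Set (Set V)} {U W t : Set V}
    (hU : U ∈ PA) (hW : W ∈ PB)
    (h : Relation.TransGen (QuotRel E (CommonRefinement PA PB)) (U ∩ W) t) :
    ∃ U' ∈ PA, ∃ W' ∈ PB, t = U' ∩ W' ∧
      Relation.ReflTransGen (QuotRel E PA) U U' ∧ Relation.ReflTransGen (QuotRel E PB) W W' ∧
      (Relation.TransGen (QuotRel E PA) U U' ∨ Relation.TransGen (QuotRel E PB) W W') := by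
  induction h with
  | single h =>
    obtain ⟨U', hU', W', hW', rfl, a, b, c⟩ := quotRel_step hU hW h
    refine ⟨U', hU', W', hW', rfl, ?_, ?_, c.imp .single .single⟩
    · rcases a with rfl | a
      exacts [.refl, .single a]
    · rcases b with rfl | b
      exacts [.refl, .single b]
  | tail _ h ih =>
    obtain ⟨U₁, hU₁, W₁, hW₁, rfl, a₁, b₁, -⟩ := ih
    obtain ⟨U', hU', W', hW', rfl, a, b, c⟩ := quotRel_step hU₁ hW₁ h
    refine ⟨U', hU', W', hW', rfl, ?_, ?_, c.imp (.tail' a₁) (.tail' b₁)⟩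
    · rcases a with rfl | a
      exacts [a₁, a₁.tail a]
    · rcases b with rfl | b
      exacts [b₁, b₁.tail b]

/-- if the quotient graph of a finite DAG by the common refinement of two
valid coarsening partitions `Π_A` and `Π_B` contains a directed cycle, then the quotient
graph by `Π_A` or the quotient graph by `Π_B` contains a directed cycle. -/
theorem cycle_in_commonRefinement_quotient
    {V : Type*} [Fintype V] (E : V → V → Prop)
    (hacyc : ∀ v, ¬ Relation.TransGen E v v)
    (PA PB : Set (Set V))
    (hA : ValidCoarsening E PA) (hB : ValidCoarsening E PB)
    (hcyc : ∃ π, Relation.TransGen (QuotRel E (CommonRefinement PA PB)) π π) :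
    (∃ π, Relation.TransGen (QuotRel E PA) π π) ∨
    (∃ π, Relation.TransGen (QuotRel E PB) π π) := by
  obtain ⟨π, h⟩ := hcyc
  obtain ⟨x, U, hU, W, hW, hπ⟩ : π ∈ CommonRefinement PA PB := by
    obtain ⟨_, h', -⟩ := Relation.TransGen.head'_iff.1 h
    exact h'.1
  subst hπ
  obtain ⟨v, hv⟩ := x
  obtain ⟨U', hU', W', hW', e, -, -, c⟩ := quotRel_path hU hW h
  have hv' : v ∈ U' ∩ W' := e ▸ hv
  have eU : U' = U := (hA.1.2 v).unique ⟨hU', hv'.1⟩ ⟨hU, hv.1⟩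
  have eW : W' = W := (hB.1.2 v).unique ⟨hW', hv'.2⟩ ⟨hW, hv.2⟩
  subst eU eW
  exact c.imp (fun h => ⟨_, h⟩) (fun h => ⟨_, h⟩)
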